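/- Let μ ∈ ℝ with μ ≠ 0. Then the meromorphic continuation F_{0, 2μ} of ζ_{0, 2μ} has at z₀ := 2|μ| at most a simple pole, and lim_{z→2|μ|} (z−2|μ|)·F_{0,2μ}(z) = −q^{|μ|}·(q^{−1}−q)^{2|μ|} / ((1−q^{2|μ|})·ln q). (This is the residue at z = 2|μ| of the zeta function tr(K^{2μ}|D|^{−z}) of the Podleś sphere spectral triple.) -/

import Mathlib

open Complex Real Filter Finset Topology

/-- The q-number `[x]_q = (q^x - q^{-x})/(q - q⁻¹)`. -/
noncomputable def qnum (q x : ℝ) : ℝ := (q ^ x - q ^ (-x)) / (q - q⁻¹)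

/-- For a positive real `a` and `w : ℂ`, `a^w := exp(w · ln a)`. -/
noncomputable def rcpow (a : ℝ) (w : ℂ) : ℂ := Complex.exp (w * (Real.log a : ℂ))

/-- The `(n,j)`-term of the q-zeta double series, corresponding to
`l = n + 1/2` and `k = j - n - 1/2`: `q^{βl+δk} · [l+1/2]_q^{-z}`. -/
noncomputable def qzetaTerm (q β δ : ℝ) (z : ℂ) (n j : ℕ) : ℂ :=
  ((q ^ (β * ((n : ℝ) + 1/2) + δ * ((j : ℝ) - (n : ℝ) - 1/2)) : ℝ) : ℂ) *
    rcpow (qnum q ((n : ℝ) + 1)) (-z)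

/-- The q-zeta function `ζ_{β,δ}(z)` as a double series. -/
noncomputable def qzeta (q β δ : ℝ) (z : ℂ) : ℂ :=
  ∑' n : ℕ, ∑ j ∈ Finset.range (2 * n + 2), qzetaTerm q β δ z n j

/-- The generalized binomial coefficient `C(z+j-1, j) = (1/j!)·∏_{i=0}^{j-1}(z+i)`. -/
noncomputable def binomC (z : ℂ) (j : ℕ) : ℂ :=
  (∏ i ∈ Finset.range j, (z + (i : ℂ))) / (Nat.factorial j : ℂ)

/-- The `j`-th term of the series defining `F_{β,δ}(z)`. -/
noncomputable def Fterm (q β δ : ℝ) (z : ℂ) (j : ℕ) : ℂ :=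
  binomC z j * (q : ℂ) ^ (2 * j) /
    ((1 - rcpow q (((β - δ + 2 * (j : ℝ)) : ℝ) + z)) *
     (1 - rcpow q (((β + δ + 2 * (j : ℝ)) : ℝ) + z)))

/-- The meromorphic continuation `F_{β,δ}`. -/
noncomputable def Ffun (q β δ : ℝ) (z : ℂ) : ℂ :=
  ((q ^ (β / 2) * (q ^ (-δ / 2) + q ^ (δ / 2)) : ℝ) : ℂ) * rcpow (1 - q ^ 2) z *
    ∑' j : ℕ, Fterm q β δ z j

lemma Ffun_zero_neg (q δ : ℝ) (z : ℂ) : Ffun q 0 (-δ) z = Ffun q 0 δ z := by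
  have h : ∀ j, Fterm q 0 (-δ) z j = Fterm q 0 δ z j := fun j => by
    simp only [Fterm, sub_neg_eq_add, ← sub_eq_add_neg]
    rw [mul_comm (1 - rcpow q _)]
  simp only [Ffun, h, neg_neg]
  rw [add_comm (q ^ (δ / 2))]

lemma norm_rcpow (a : ℝ) (w : ℂ) : ‖rcpow a w‖ = Real.exp (w.re * Real.log a) := by
  simp [rcpow, Complex.norm_exp]

lemma rcpow_ofReal {a : ℝ} (ha : 0 < a) (x : ℝ) : rcpow a (x : ℂ) = ((a ^ x : ℝ) : ℂ) := by
  rw [rcpow, Real.rpow_def_of_pos ha, mul_comm]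
  push_cast
  rfl

lemma continuous_rcpow (a : ℝ) : Continuous (rcpow a) := by
  unfold rcpow
  fun_prop

/-- If `1 ≤ Re w`, then `1 - q^w` is bounded away from zero by `1 - q`. -/
lemma one_sub_le_norm_one_sub_rcpow {q : ℝ} (hq0 : 0 < q) (hq1 : q < 1) {w : ℂ}
    (hw : 1 ≤ w.re) : 1 - q ≤ ‖1 - rcpow q w‖ := by
  have h1 : ‖rcpow q w‖ ≤ q := by
    rw [norm_rcpow]
    calc Real.exp (w.re * Real.log q) ≤ Real.exp (Real.log q) := by
          apply Real.exp_le_exp.2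
          nlinarith [Real.log_neg hq0 hq1]
      _ = q := Real.exp_log hq0
  have h2 := norm_sub_norm_le (1 : ℂ) (rcpow q w)
  rw [norm_one] at h2
  linarith

lemma norm_binomC_le {z : ℂ} {R : ℝ} (hz : ‖z‖ ≤ R) (j : ℕ) :
    ‖binomC z j‖ ≤ (∏ i ∈ Finset.range j, (R + i)) / (Nat.factorial j : ℝ) := by
  rw [binomC, norm_div, norm_prod, Complex.norm_natCast]
  gcongr with i _
  calc ‖z + (i : ℂ)‖ ≤ ‖z‖ + ‖(i : ℂ)‖ := norm_add_le _ _
    _ ≤ R + i := by rw [Complex.norm_natCast]; gcongr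

lemma summable_prod_add_div_factorial_mul_pow {R x : ℝ} (hR : 0 < R) (hx0 : 0 < x)
    (hx1 : x < 1) :
    Summable fun j : ℕ => (∏ i ∈ Finset.range j, (R + i)) / (Nat.factorial j : ℝ) * x ^ j := by
  have hpos : ∀ j : ℕ, 0 < (∏ i ∈ Finset.range j, (R + i)) / (Nat.factorial j : ℝ) * x ^ j :=
    fun j => by
      have : 0 < ∏ i ∈ Finset.range j, (R + (i : ℝ)) := Finset.prod_pos fun i _ => by positivity
      positivity
  refine summable_of_ratio_test_tendsto_lt_one hx1 (.of_forall fun j => (hpos j).ne') ?_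
  have hlim : Tendsto (fun j : ℕ => (1 + (R - 1) / ((j : ℝ) + 1)) * x) atTop (𝓝 x) := by
    have h : Tendsto (fun j : ℕ => (R - 1) / ((j : ℝ) + 1)) atTop (𝓝 0) :=
      tendsto_const_nhds.div_atTop (tendsto_atTop_add_const_right _ _ tendsto_natCast_atTop_atTop)
    simpa using (h.const_add 1).mul_const x
  refine hlim.congr fun j => ?_
  have hP : (∏ i ∈ Finset.range j, (R + (i : ℝ))) ≠ 0 :=
    (Finset.prod_pos fun i _ => by positivity).ne'
  rw [Real.norm_of_nonneg (hpos _).le, Real.norm_of_nonneg (hpos _).le,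
    Finset.prod_range_succ, Nat.factorial_succ, pow_succ]
  push_cast
  field_simp
  ring

lemma tendsto_sub_div_one_sub_rcpow {q : ℝ} (hq0 : 0 < q) (hq1 : q < 1) (a : ℂ) :
    Tendsto (fun z : ℂ => (z - a) / (1 - rcpow q (z - a))) (𝓝[≠] a)
      (𝓝 (-(Real.log q : ℂ)⁻¹)) := by
  have hL : (Real.log q : ℂ) ≠ 0 := by exact_mod_cast (Real.log_neg hq0 hq1).ne
  have hd : HasDerivAt (fun z : ℂ => rcpow q (z - a)) (Real.log q : ℂ) a := by
    have h := (((hasDerivAt_id a).sub_const a).mul_const (Real.log q : ℂ)).cexp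
    simpa [rcpow] using h
  have h := ((hasDerivAt_iff_tendsto_slope.1 hd).inv₀ hL).neg
  refine h.congr fun z => ?_
  have h0 : rcpow q 0 = 1 := by simp [rcpow]
  rw [slope_def_field, inv_div, sub_self, h0, ← div_neg, neg_sub]

/-- The zeroth term of the series for `F_{0,2m}` carries the simple pole at `2m`. -/
lemma tendsto_sub_mul_Fterm_zero {q : ℝ} (hq0 : 0 < q) (hq1 : q < 1) {m : ℝ} (hm : 0 < m) :
    Tendsto (fun z : ℂ => (z - ((2 * m : ℝ) : ℂ)) * Fterm q 0 (2 * m) z 0)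
      (𝓝[≠] ((2 * m : ℝ) : ℂ))
      (𝓝 (-(Real.log q : ℂ)⁻¹ * (1 - ((q ^ (4 * m) : ℝ) : ℂ))⁻¹)) := by
  have hne : (1 - ((q ^ (4 * m) : ℝ) : ℂ)) ≠ 0 := by
    have : q ^ (4 * m) < 1 := Real.rpow_lt_one hq0.le hq1 (by positivity)
    exact_mod_cast (sub_pos.2 this).ne'
  have h2 : Tendsto (fun z : ℂ => 1 - rcpow q (((2 * m : ℝ) : ℂ) + z))
      (𝓝[≠] ((2 * m : ℝ) : ℂ)) (𝓝 (1 - ((q ^ (4 * m) : ℝ) : ℂ))) := by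
    have hc : Continuous fun z : ℂ => 1 - rcpow q (((2 * m : ℝ) : ℂ) + z) :=
      continuous_const.sub ((continuous_rcpow q).comp (by fun_prop))
    have := hc.tendsto ((2 * m : ℝ) : ℂ)
    rw [← Complex.ofReal_add, rcpow_ofReal hq0, show 2 * m + 2 * m = 4 * m by ring] at this
    exact this.mono_left nhdsWithin_le_nhds
  refine ((tendsto_sub_div_one_sub_rcpow hq0 hq1 _).mul (h2.inv₀ hne)).congr fun z => ?_
  have e1 : ((0 - 2 * m + 2 * ((0 : ℕ) : ℝ) : ℝ) : ℂ) + z = z - ((2 * m : ℝ) : ℂ) := by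
    push_cast; ring
  have e2 : ((0 + 2 * m + 2 * ((0 : ℕ) : ℝ) : ℝ) : ℂ) + z = ((2 * m : ℝ) : ℂ) + z := by
    push_cast; ring
  rw [Fterm, e1, e2]
  simp only [binomC, Finset.range_zero, Finset.prod_empty, Nat.factorial_zero, Nat.cast_one,
    mul_zero, pow_zero, mul_one, mul_inv, div_eq_mul_inv, one_mul, inv_one]
  ring

/-- Near `2m`, the terms of positive index are dominated by a convergent series. -/
lemma norm_Fterm_le {q : ℝ} (hq0 : 0 < q) (hq1 : q < 1) {m : ℝ} (hm : 0 < m) {z : ℂ}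
    (hz : ‖z - ((2 * m : ℝ) : ℂ)‖ ≤ 1) {j : ℕ} (hj : j ≠ 0) :
    ‖Fterm q 0 (2 * m) z j‖ ≤
      (∏ i ∈ Finset.range j, (2 * m + 1 + i)) / (Nat.factorial j : ℝ) * (q ^ 2) ^ j /
        ((1 - q) * (1 - q)) := by
  have hzR : ‖z‖ ≤ 2 * m + 1 := by
    have h := norm_le_norm_add_norm_sub' z ((2 * m : ℝ) : ℂ)
    rw [Complex.norm_of_nonneg (by positivity : (0 : ℝ) ≤ 2 * m)] at h
    linarith
  have hre : 2 * m - 1 ≤ z.re := by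
    have h := (abs_le.1 ((Complex.abs_re_le_norm _).trans hz)).1
    rw [Complex.sub_re, Complex.ofReal_re] at h
    linarith
  have hj1 : (1 : ℝ) ≤ j := by exact_mod_cast Nat.one_le_iff_ne_zero.2 hj
  have h1q : 0 < 1 - q := sub_pos.2 hq1
  have hb := norm_binomC_le hzR j
  have h1 : 1 - q ≤ ‖1 - rcpow q (((0 - 2 * m + 2 * (j : ℝ)) : ℝ) + z)‖ :=
    one_sub_le_norm_one_sub_rcpow hq0 hq1 (by rw [Complex.add_re, Complex.ofReal_re]; linarith)
  have h2 : 1 - q ≤ ‖1 - rcpow q (((0 + 2 * m + 2 * (j : ℝ)) : ℝ) + z)‖ :=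
    one_sub_le_norm_one_sub_rcpow hq0 hq1 (by rw [Complex.add_re, Complex.ofReal_re]; linarith)
  rw [Fterm, norm_div, norm_mul, norm_mul, norm_pow, Complex.norm_of_nonneg hq0.le, pow_mul]
  have h0 := (norm_nonneg _).trans hb
  gcongr

lemma continuousAt_Fterm {q : ℝ} (hq0 : 0 < q) (hq1 : q < 1) {m : ℝ} (hm : 0 < m) {j : ℕ}
    (hj : j ≠ 0) : ContinuousAt (fun z => Fterm q 0 (2 * m) z j) ((2 * m : ℝ) : ℂ) := by
  have hj1 : (1 : ℝ) ≤ j := by exact_mod_cast Nat.one_le_iff_ne_zero.2 hj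
  have hne : ∀ w : ℂ, 1 ≤ w.re → 1 - rcpow q w ≠ 0 := fun w hw =>
    norm_pos_iff.1 ((sub_pos.2 hq1).trans_le (one_sub_le_norm_one_sub_rcpow hq0 hq1 hw))
  have hc := continuous_rcpow q
  unfold Fterm binomC
  refine ContinuousAt.div (by fun_prop) (by fun_prop) (mul_ne_zero (hne _ ?_) (hne _ ?_)) <;>
    · rw [Complex.add_re, Complex.ofReal_re, Complex.ofReal_re]; linarith

lemma tendsto_sub_mul_tsum_Fterm {q : ℝ} (hq0 : 0 < q) (hq1 : q < 1) {m : ℝ} (hm : 0 < m) :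
    Tendsto (fun z : ℂ => (z - ((2 * m : ℝ) : ℂ)) * ∑' j : ℕ, Fterm q 0 (2 * m) z j)
      (𝓝[≠] ((2 * m : ℝ) : ℂ))
      (𝓝 (-(Real.log q : ℂ)⁻¹ * (1 - ((q ^ (4 * m) : ℝ) : ℂ))⁻¹)) := by
  set c : ℂ := -(Real.log q : ℂ)⁻¹ * (1 - ((q ^ (4 * m) : ℝ) : ℂ))⁻¹ with hc
  have h0 := tendsto_sub_mul_Fterm_zero hq0 hq1 hm
  rw [← hc] at h0
  set B : ℕ → ℝ := fun j => (∏ i ∈ Finset.range j, (2 * m + 1 + i)) / (Nat.factorial j : ℝ) *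
    (q ^ 2) ^ j / ((1 - q) * (1 - q))
  have hBs : Summable B :=
    (summable_prod_add_div_factorial_mul_pow (by positivity) (by positivity)
      (pow_lt_one₀ hq0.le hq1 two_ne_zero)).div_const _
  have hball : ∀ᶠ z in 𝓝[≠] ((2 * m : ℝ) : ℂ), ‖z - ((2 * m : ℝ) : ℂ)‖ ≤ 1 := by
    filter_upwards [nhdsWithin_le_nhds (Metric.closedBall_mem_nhds ((2 * m : ℝ) : ℂ) one_pos)]
      with z hz
    rwa [← dist_eq_norm]
  have hnorm : ∀ᶠ z in 𝓝[≠] ((2 * m : ℝ) : ℂ),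
      ‖(z - ((2 * m : ℝ) : ℂ)) * Fterm q 0 (2 * m) z 0‖ ≤ ‖c‖ + 1 :=
    h0.norm.eventually_le_const (lt_add_one _)
  have key := tendsto_tsum_of_dominated_convergence
    (f := fun z j => (z - ((2 * m : ℝ) : ℂ)) * Fterm q 0 (2 * m) z j)
    (g := fun j : ℕ => if j = 0 then c else 0) (𝓕 := 𝓝[≠] ((2 * m : ℝ) : ℂ))
    (bound := Function.update B 0 (‖c‖ + 1)) (hBs.update 0 _) ?_ ?_
  · simpa only [tsum_mul_left, tsum_ite_eq] using key
  · intro j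
    rcases eq_or_ne j 0 with rfl | hj
    · simpa using h0
    · have hs : ContinuousAt (fun z : ℂ => z - ((2 * m : ℝ) : ℂ)) ((2 * m : ℝ) : ℂ) := by fun_prop
      have h := hs.tendsto.mul (continuousAt_Fterm hq0 hq1 hm hj).tendsto
      rw [sub_self, zero_mul] at h
      simpa only [if_neg hj] using h.mono_left nhdsWithin_le_nhds
  · filter_upwards [hball, hnorm] with z hz hz0 j
    rcases eq_or_ne j 0 with rfl | hj
    · simpa using hz0
    · rw [Function.update_of_ne hj, norm_mul]
      exact (mul_le_of_le_one_left (norm_nonneg _) hz).trans (norm_Fterm_le hq0 hq1 hm hz hj)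

lemma residue_constant_eq {q : ℝ} (hq0 : 0 < q) (hq1 : q < 1) {m : ℝ} (hm : 0 < m) :
    (q ^ (-m) + q ^ m) * (1 - q ^ 2) ^ (2 * m) *
        (-(Real.log q)⁻¹ * (1 - q ^ (4 * m))⁻¹) =
      -(q ^ m * (q⁻¹ - q) ^ (2 * m)) / ((1 - q ^ (2 * m)) * Real.log q) := by
  have hL := (Real.log_neg hq0 hq1).ne
  have hx0 : 0 < q ^ m := Real.rpow_pos_of_pos hq0 m
  have hx1 : q ^ m < 1 := Real.rpow_lt_one hq0.le hq1 hm
  have e1 : q ^ (2 * m) = (q ^ m) ^ 2 := by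
    rw [mul_comm, Real.rpow_mul hq0.le, Real.rpow_two]
  have e2 : q ^ (4 * m) = (q ^ m) ^ 4 := by
    rw [mul_comm, Real.rpow_mul hq0.le]; norm_cast
  have e3 : (q⁻¹ - q) ^ (2 * m) = (1 - q ^ 2) ^ (2 * m) / (q ^ m) ^ 2 := by
    rw [← e1, ← Real.div_rpow (by nlinarith) hq0.le]
    congr 1
    field_simp
  have hx2 : 1 - (q ^ m) ^ 2 ≠ 0 := (sub_pos.2 (pow_lt_one₀ hx0.le hx1 two_ne_zero)).ne'
  have hx4 : 1 - (q ^ m) ^ 4 ≠ 0 := (sub_pos.2 (pow_lt_one₀ hx0.le hx1 four_ne_zero)).ne'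
  rw [e1, e2, e3, Real.rpow_neg hq0.le]
  field_simp
  ring

lemma tendsto_sub_mul_Ffun {q : ℝ} (hq0 : 0 < q) (hq1 : q < 1) {m : ℝ} (hm : 0 < m) :
    Tendsto (fun z : ℂ => (z - ((2 * m : ℝ) : ℂ)) * Ffun q 0 (2 * m) z)
      (𝓝[≠] ((2 * m : ℝ) : ℂ))
      (𝓝 ((-(q ^ m * (q⁻¹ - q) ^ (2 * m)) /
        ((1 - q ^ (2 * m)) * Real.log q) : ℝ) : ℂ)) := by
  have hr : Tendsto (rcpow (1 - q ^ 2)) (𝓝[≠] ((2 * m : ℝ) : ℂ))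
      (𝓝 (((1 - q ^ 2) ^ (2 * m) : ℝ) : ℂ)) := by
    rw [← rcpow_ofReal (by nlinarith)]
    exact ((continuous_rcpow _).tendsto _).mono_left nhdsWithin_le_nhds
  have h := (hr.const_mul (((q ^ (-m) + q ^ m) : ℝ) : ℂ)).mul
    (tendsto_sub_mul_tsum_Fterm hq0 hq1 hm)
  rw [← residue_constant_eq hq0 hq1 hm]
  push_cast at h ⊢
  refine h.congr fun z => ?_
  have e1 : -(2 * m) / 2 = -m := by ring
  have e2 : 2 * m / 2 = m := by ring
  rw [Ffun, e1, e2, zero_div, Real.rpow_zero, one_mul]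
  push_cast
  ring

theorem statement17 (q : ℝ) (hq0 : 0 < q) (hq1 : q < 1) (μ : ℝ) (hμ : μ ≠ 0) :
    Tendsto (fun z : ℂ => (z - ((2 * |μ| : ℝ) : ℂ)) * Ffun q 0 (2 * μ) z)
      (𝓝[≠] ((2 * |μ| : ℝ) : ℂ))
      (𝓝 ((-(q ^ |μ| * (q⁻¹ - q) ^ (2 * |μ|)) /
        ((1 - q ^ (2 * |μ|)) * Real.log q) : ℝ) : ℂ)) := by
  have h := tendsto_sub_mul_Ffun hq0 hq1 (abs_pos.2 hμ)
  rcases abs_cases μ with ⟨e, _⟩ | ⟨e, _⟩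
  · rwa [e] at h ⊢
  · refine h.congr fun z => ?_
    rw [← Ffun_zero_neg q (2 * μ), ← mul_neg, ← e]
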